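/- (Gyarmati–Matolcsi–Ruzsa sub-multiplicativity) Let A₁, …, A_K (K ≥ 2) be finite nonempty subsets of a commutative monoid, and for each i let Bᵢ = ∑_{j ≠ i} A_j be the sumset of all sets except Aᵢ. Then |A₁ + ⋯ + A_K|^(K−1) ≤ ∏_{i=1}^K |Bᵢ|. -/

import Mathlib

open Pointwise

/-- Hölder's inequality for finitely many factors, in a root-free form for natural numbers. -/
theorem sum_pow_card_le_mul_prod_sum {ι τ : Type*} (s : Finset ι) (T : Finset τ) (f : τ → ℕ)
    (g : ι → τ → ℕ) {P : ℕ} (hP : 1 ≤ P)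
    (h : ∀ t ∈ T, f t ^ s.card ≤ P * ∏ i ∈ s, g i t) :
    (∑ t ∈ T, f t) ^ s.card ≤ P * ∏ i ∈ s, ∑ t ∈ T, g i t := by
  rcases s.eq_empty_or_nonempty with rfl | hs
  · simpa using hP
  have hm : (s.card : ℝ) ≠ 0 := by exact_mod_cast hs.card_pos.ne'
  have hm0 : (0 : ℝ) ≤ (s.card : ℝ)⁻¹ := by positivity
  have root_pow (x : ENNReal) : (x ^ (s.card : ℝ)⁻¹) ^ s.card = x := by
    rw [← ENNReal.rpow_natCast, ← ENNReal.rpow_mul, inv_mul_cancel₀ hm, ENNReal.rpow_one]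
  have pow_root (x : ENNReal) : (x ^ s.card) ^ (s.card : ℝ)⁻¹ = x := by
    rw [← ENNReal.rpow_natCast, ← ENNReal.rpow_mul, mul_inv_cancel₀ hm, ENNReal.rpow_one]
  let _ : MeasurableSpace T := ⊤
  have holder := ENNReal.lintegral_prod_norm_pow_le (μ := MeasureTheory.Measure.count) s
    (f := fun i (t : T) => (g i t : ENNReal)) (fun i _ => measurable_from_top.aemeasurable)
    (p := fun _ => (s.card : ℝ)⁻¹) (by simp [hm]) (fun _ _ => hm0)
  simp only [MeasureTheory.lintegral_count, tsum_fintype] at holder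
  have bound (t : T) : (f t : ENNReal) ≤
      (P : ENNReal) ^ (s.card : ℝ)⁻¹ * ∏ i ∈ s, (g i t : ENNReal) ^ (s.card : ℝ)⁻¹ := by
    rw [ENNReal.prod_rpow_of_nonneg hm0, ← ENNReal.mul_rpow_of_nonneg _ _ hm0,
      ← pow_root (f t : ENNReal)]
    exact ENNReal.rpow_le_rpow (by exact_mod_cast h t t.2) hm0
  have total : (∑ t : T, (f t : ENNReal)) ≤
      (P : ENNReal) ^ (s.card : ℝ)⁻¹ * ∏ i ∈ s, (∑ t : T, (g i t : ENNReal)) ^ (s.card : ℝ)⁻¹ :=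
    (Finset.sum_le_sum fun t _ => bound t).trans
      ((Finset.mul_sum _ _ _).symm.le.trans (by gcongr))
  have := pow_le_pow_left' total s.card
  rw [mul_pow, root_pow, ← Finset.prod_pow] at this
  simp only [root_pow, Finset.sum_coe_sort T (fun t => (f t : ENNReal)),
    fun i => Finset.sum_coe_sort T (fun t => (g i t : ENNReal))] at this
  exact_mod_cast this

/-- The discrete Loomis–Whitney inequality for a set of tuples that agree off `s`. Projecting away
the coordinate `i` is expressed as overwriting it with a fixed value `c`. -/
theorem card_pow_le_card_mul_prod_card_image_update {ι M : Type*} [DecidableEq ι] [DecidableEq M]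
    [Fintype ι] (c : M) (s : Finset ι) (X : Finset (ι → M)) (hX : X.Nonempty)
    (hs : ∀ x ∈ X, ∀ y ∈ X, ∀ i ∉ s, x i = y i) :
    X.card ^ s.card ≤ X.card * ∏ i ∈ s, (X.image fun x => Function.update x i c).card := by
  induction s using Finset.induction_on generalizing X with
  | empty => simpa using hX
  | insert a s ha ih =>
    have slice (t) (ht : t ∈ X.image (· a)) : (X.filter (· a = t)).card ^ s.card ≤
        (X.image fun x => Function.update x a c).card *
          ∏ i ∈ s, ((X.filter (· a = t)).image fun x => Function.update x i c).card := by
      refine (ih _ ?_ ?_).trans (Nat.mul_le_mul_right _ ?_)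
      · obtain ⟨x, hx, rfl⟩ := Finset.mem_image.1 ht
        exact ⟨x, by simp [hx]⟩
      · intro x hx y hy i hi
        rw [Finset.mem_filter] at hx hy
        by_cases hia : i = a
        · rw [hia, hx.2, hy.2]
        · exact hs x hx.1 y hy.1 i (by simp [hi, hia])
      · refine Finset.card_le_card_of_injOn (fun x => Function.update x a c) ?_ ?_
        · intro x hx
          exact Finset.mem_image_of_mem _ (Finset.mem_filter.1 hx).1
        · intro x hx y hy hxy
          have hx := (Finset.mem_filter.1 hx).2
          have hy := (Finset.mem_filter.1 hy).2
          funext i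
          by_cases hia : i = a
          · rw [hia, hx, hy]
          · simpa [hia] using congrFun hxy i
    have fibers (i) (hi : i ∈ s) : (X.image fun x => Function.update x i c).card =
        ∑ t ∈ X.image (· a), ((X.filter (· a = t)).image fun x => Function.update x i c).card := by
      have hai : a ≠ i := fun h => ha (h ▸ hi)
      rw [Finset.card_eq_sum_card_fiberwise (f := (· a)) (t := X.image (· a))]
      · refine Finset.sum_congr rfl fun t _ => ?_
        rw [Finset.filter_image]
        simp [hai]
      · intro y hy
        obtain ⟨x, hx, rfl⟩ := Finset.mem_image.1 hy
        simpa [hai] using ⟨x, hx, rfl⟩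
    have key := sum_pow_card_le_mul_prod_sum s (X.image (· a)) _ _
      (Finset.card_pos.2 (hX.image _)) slice
    rw [← Finset.card_eq_sum_card_image, ← Finset.prod_congr rfl fibers] at key
    rw [Finset.card_insert_of_notMem ha, Finset.prod_insert ha, pow_succ']
    exact Nat.mul_le_mul_left _ key

/-- Overwriting a coordinate at which two tuples agree preserves their lexicographic order. -/
theorem toLex_update_le_toLex_update {ι M : Type*} [LinearOrder ι] [WellFoundedLT ι]
    [LinearOrder M] {x y : ι → M} {i : ι} (c : M) (h : toLex x ≤ toLex y) (hi : x i = y i) :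
    toLex (Function.update x i c) ≤ toLex (Function.update y i c) := by
  rcases h.eq_or_lt with h | ⟨k, hk, hlt⟩
  · rw [toLex_inj.1 h]
  · have hki : k ≠ i := by
      rintro rfl
      exact hlt.ne hi
    refine le_of_lt ⟨k, fun j hj => ?_, ?_⟩
    · by_cases hji : j = i
      · simp [hji]
      · simpa [hji] using hk j hj
    · simpa [hki] using hlt

/-- Elements of a sumset of finsets are the sums of choices of one element of each summand. -/
theorem mem_finset_sum_iff {ι M : Type*} [AddCommMonoid M] [DecidableEq M] {s : Finset ι}
    {A : ι → Finset M} {m : M} :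
    m ∈ ∑ i ∈ s, A i ↔ ∃ x : ι → M, (∀ i ∈ s, x i ∈ A i) ∧ ∑ i ∈ s, x i = m := by
  rw [← Finset.mem_coe, Finset.coe_sum, Set.mem_finsetSum]
  simp

/-- The elements of a sumset have representations whose truncations, with one coordinate
overwritten, are determined by their partial sums. -/
theorem exists_representation_update_injective {ι M : Type*} [Fintype ι] [LinearOrder ι]
    [AddCommMonoid M] [DecidableEq M] (A : ι → Finset M) (c : M) :
    ∃ r : M → ι → M, (∀ m ∈ ∑ i, A i, (∀ i, r m i ∈ A i) ∧ ∑ i, r m i = m) ∧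
      ∀ m ∈ ∑ i, A i, ∀ n ∈ ∑ i, A i, ∀ i,
        ∑ j ∈ Finset.univ.erase i, r m j = ∑ j ∈ Finset.univ.erase i, r n j →
          Function.update (r m) i c = Function.update (r n) i c := by
  let _ : LinearOrder M := IsWellOrder.linearOrder WellOrderingRel
  have hmin (m : M) : ∃ x : ι → M, m ∈ ∑ i, A i → ((∀ i, x i ∈ A i) ∧ ∑ i, x i = m) ∧
      ∀ y : ι → M, (∀ i, y i ∈ A i) → ∑ i, y i = m → toLex x ≤ toLex y := by
    by_cases hm : m ∈ ∑ i, A i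
    · obtain ⟨y, hy, hym⟩ := mem_finset_sum_iff.1 hm
      obtain ⟨x, hx, hle⟩ := ((Fintype.piFinset A).filter (∑ i, · i = m)).exists_min_image toLex
        ⟨y, by simpa [hym] using hy⟩
      refine ⟨x, fun _ => ⟨by simpa using hx, fun z hz hzm => hle z ?_⟩⟩
      simpa [hzm] using hz
    · exact ⟨fun _ => m, fun h => absurd h hm⟩
  choose r hr using hmin
  have hle {m n : M} (hm : m ∈ ∑ i, A i) (hn : n ∈ ∑ i, A i) {i : ι}
      (h : ∑ j ∈ Finset.univ.erase i, r m j = ∑ j ∈ Finset.univ.erase i, r n j) :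
      toLex (Function.update (r m) i c) ≤ toLex (Function.update (r n) i c) := by
    have hmem (j : ι) : Function.update (r n) i (r m i) j ∈ A j := by
      by_cases hji : j = i
      · subst hji
        simpa using (hr m hm).1.1 j
      · simpa [hji] using (hr n hn).1.1 j
    have hsum : ∑ j, Function.update (r n) i (r m i) j = m := by
      rw [Finset.sum_update_of_mem (Finset.mem_univ i), Finset.sdiff_singleton_eq_erase, ← h,
        Finset.add_sum_erase _ _ (Finset.mem_univ i), (hr m hm).1.2]
    simpa using toLex_update_le_toLex_update c ((hr m hm).2 _ hmem hsum) (i := i) (by simp)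
  exact ⟨r, fun m hm => (hr m hm).1, fun m hm n hn i h =>
    toLex_inj.1 (le_antisymm (hle hm hn h) (hle hn hm h.symm))⟩

theorem gmr_submultiplicativity {M : Type*} [AddCommMonoid M] [DecidableEq M]
    (K : ℕ) (hK : 2 ≤ K) (A : Fin K → Finset M) (hA : ∀ i, (A i).Nonempty) :
    (∑ i, A i).card ^ (K - 1) ≤ ∏ i, (∑ j ∈ Finset.univ.erase i, A j).card := by
  obtain ⟨r, hr, hinj⟩ := exists_representation_update_injective A 0
  have hS : (∑ i, A i).Nonempty := by
    choose x hx using hA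
    exact ⟨_, mem_finset_sum_iff.2 ⟨x, fun i _ => hx i, rfl⟩⟩
  have hcard : ((∑ i, A i).image r).card = (∑ i, A i).card :=
    Finset.card_image_of_injOn fun m hm n hn h => by
      rw [← (hr m hm).2, ← (hr n hn).2, h]
  have hLW := card_pow_le_card_mul_prod_card_image_update 0 Finset.univ _ (hS.image r)
    (fun _ _ _ _ i hi => absurd (Finset.mem_univ i) hi)
  rw [hcard, Finset.card_univ, Fintype.card_fin,
    ← mul_pow_sub_one (by omega : K ≠ 0)] at hLW
  refine (Nat.le_of_mul_le_mul_left hLW hS.card_pos).trans (Finset.prod_le_prod' fun i _ => ?_)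
  have hupdate (x : Fin K → M) : ∑ j ∈ Finset.univ.erase i, Function.update x i 0 j =
      ∑ j ∈ Finset.univ.erase i, x j :=
    Finset.sum_congr rfl fun j hj => by simp [Finset.ne_of_mem_erase hj]
  refine Finset.card_le_card_of_injOn (fun x => ∑ j ∈ Finset.univ.erase i, x j) ?_ ?_
  · intro y hy
    simp only [Finset.coe_image, Set.mem_image, Finset.mem_coe] at hy
    obtain ⟨_, ⟨m, hm, rfl⟩, rfl⟩ := hy
    exact mem_finset_sum_iff.2 ⟨r m, fun j _ => (hr m hm).1 j, (hupdate _).symm⟩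
  · intro y hy z hz hyz
    simp only [Finset.coe_image, Set.mem_image, Finset.mem_coe] at hy hz
    obtain ⟨_, ⟨m, hm, rfl⟩, rfl⟩ := hy
    obtain ⟨_, ⟨n, hn, rfl⟩, rfl⟩ := hz
    simp only [hupdate] at hyz
    exact hinj m hm n hn i hyz
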